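/- arXiv:1205.6706 — 3 statements merged into one kernel-verified Lean document; each statement's English description precedes it below -/
import Mathlib

section
/- For all natural numbers m, n, s and every complex number d with Re(d) > 0, there holds ₄F₃(1 + 2m, 1 + 2n, 1 + m + n + s, d+1; m + n + 3/2, 3 + 2m + 2n + 2s, d; 1) = (π/4) · ((3/2)_{m+n+s} (3/2)_{m+n} (1/2)_s) / ((1/2)_m (1/2)_n m! n!) · [ π (1/2)_m (1/2)_n / ((m+s)! (n+s)!) + (1/π) ((2 + 2m + 2n + 2s)/d − 1) m! n! / ((1/2)_{m+s+1} (1/2)_{n+s+1}) ]. -/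
open scoped Nat

/-- Pochhammer symbol `(x)_k = x (x+1) ⋯ (x+k-1)` for a complex number `x`. -/
noncomputable def poch (x : ℂ) (k : ℕ) : ℂ := (ascPochhammer ℂ k).eval x

/-- The generalized hypergeometric series
`ₚF_q(a₁,…,aₚ; b₁,…,b_q; z) = ∑ₖ ((a₁)ₖ ⋯ (aₚ)ₖ)/((b₁)ₖ ⋯ (b_q)ₖ) · zᵏ/k!`. -/
noncomputable def hyp (a b : List ℂ) (z : ℂ) : ℂ :=
  ∑' k : ℕ, ((a.map (poch · k)).prod / (b.map (poch · k)).prod) * z ^ k / (k ! : ℂ)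


section

open Filter Finset Topology

/-- The rising factorial of a real number. -/
noncomputable def rf (x : ℝ) (k : ℕ) : ℝ := ∏ j ∈ range k, (x + j)

lemma rf_zero (x : ℝ) : rf x 0 = 1 := by simp [rf]

lemma rf_succ (x : ℝ) (k : ℕ) : rf x (k + 1) = rf x k * (x + k) := by
  simp [rf, prod_range_succ]

lemma rf_succ' (x : ℝ) (k : ℕ) : rf x (k + 1) = x * rf (x + 1) k := by
  simp only [rf, prod_range_succ']
  rw [mul_comm]
  congr 1
  · simp
  · refine prod_congr rfl fun j _ => ?_
    push_cast; ring

lemma mul_rf_add_one (x : ℝ) (k : ℕ) : x * rf (x + 1) k = rf x k * (x + k) := by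
  rw [← rf_succ', rf_succ]

lemma rf_add_one {x : ℝ} (hx : x ≠ 0) (k : ℕ) : rf (x + 1) k = rf x k * (x + k) / x := by
  rw [← mul_rf_add_one]; field_simp

lemma rf_pos {x : ℝ} (hx : 0 < x) (k : ℕ) : 0 < rf x k :=
  prod_pos fun j _ => by positivity

lemma rf_one (k : ℕ) : rf 1 k = (k ! : ℝ) := by
  induction k with
  | zero => simp [rf]
  | succ k ih => rw [rf_succ, ih, Nat.factorial_succ]; push_cast; ring

lemma Gamma_add_natCast {x : ℝ} (hx : 0 < x) (k : ℕ) :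
    Real.Gamma (x + k) = Real.Gamma x * rf x k := by
  induction k with
  | zero => simp [rf]
  | succ k ih =>
    rw [Nat.cast_succ, ← add_assoc, Real.Gamma_add_one (by positivity), ih, rf_succ]
    ring

lemma poch_ofReal (x : ℝ) (k : ℕ) : poch (x : ℂ) k = (rf x k : ℂ) := by
  induction k with
  | zero => simp [poch, rf]
  | succ k ih =>
    rw [rf_succ, Complex.ofReal_mul, ← ih]
    simp [poch, ascPochhammer_succ_eval]

/-- The ratio of `(x)_k` to its leading asymptotic `k ^ (x - 1) * k!`. -/
lemma tendsto_rf {x : ℝ} (hx : 0 < x) :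
    Tendsto (fun k : ℕ => rf x k * (k : ℝ) ^ (1 - x) / (k ! : ℝ)) atTop
      (𝓝 (Real.Gamma x)⁻¹) := by
  have h1 := (Real.GammaSeq_tendsto_Gamma x).inv₀ (Real.Gamma_pos_of_pos hx).ne'
  have h2 : Tendsto (fun k : ℕ => (k : ℝ) / (k + x)) atTop (𝓝 1) :=
    tendsto_natCast_div_add_atTop x
  have h3 := h1.mul h2
  rw [mul_one] at h3
  refine h3.congr' ?_
  filter_upwards [eventually_gt_atTop 0] with k hk
  have hk' : (0 : ℝ) < k := by exact_mod_cast hk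
  have h4 : ∏ j ∈ range (k + 1), (x + (j : ℝ)) = rf x k * (x + k) := rf_succ x k
  rw [Real.GammaSeq, h4, Real.rpow_sub hk', Real.rpow_one]
  have := Real.rpow_pos_of_pos hk' x
  have := rf_pos hx k
  field_simp
  ring

/-- The general term of Watson's series `₃F₂(a, b, c; (a + b + 1) / 2, 2 * c; 1)`. -/
noncomputable def watsonTerm (a b c : ℝ) (k : ℕ) : ℝ :=
  rf a k * rf b k * rf c k / (rf ((a + b + 1) / 2) k * rf (2 * c) k * (k ! : ℝ))

/-- The general term of Gauss's series `₂F₁(a, b; (a + b + 1) / 2; 1 / 2)`. -/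
noncomputable def gaussTerm (a b : ℝ) (k : ℕ) : ℝ :=
  rf a k * rf b k / (rf ((a + b + 1) / 2) k * (k ! : ℝ) * 2 ^ k)

lemma watsonTerm_pos {a b c : ℝ} (ha : 0 < a) (hb : 0 < b) (hc : 0 < c) (k : ℕ) :
    0 < watsonTerm a b c k := by
  have := rf_pos ha k
  have := rf_pos hb k
  have := rf_pos hc k
  have := rf_pos (show 0 < (a + b + 1) / 2 by positivity) k
  have := rf_pos (show 0 < 2 * c by positivity) k
  unfold watsonTerm
  positivity

lemma gaussTerm_pos {a b : ℝ} (ha : 0 < a) (hb : 0 < b) (k : ℕ) : 0 < gaussTerm a b k := by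
  have := rf_pos ha k
  have := rf_pos hb k
  have := rf_pos (show 0 < (a + b + 1) / 2 by positivity) k
  unfold gaussTerm
  positivity

lemma tendsto_watsonTerm_mul_rpow {a b c : ℝ} (ha : 0 < a) (hb : 0 < b) (hc : 0 < c) :
    ∃ L : ℝ, Tendsto (fun k : ℕ => watsonTerm a b c k * (k : ℝ) ^ (c - (a + b) / 2 + 3 / 2))
      atTop (𝓝 L) := by
  have he : 0 < (a + b + 1) / 2 := by positivity
  have h2c : 0 < 2 * c := by positivity
  have hn := ((tendsto_rf ha).mul (tendsto_rf hb)).mul (tendsto_rf hc)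
  have hd := (tendsto_rf he).mul (tendsto_rf h2c)
  have hne : (Real.Gamma ((a + b + 1) / 2))⁻¹ * (Real.Gamma (2 * c))⁻¹ ≠ 0 := by
    have := Real.Gamma_pos_of_pos he
    have := Real.Gamma_pos_of_pos h2c
    positivity
  refine ⟨_, (hn.div hd hne).congr' ?_⟩
  filter_upwards [eventually_gt_atTop 0] with k hk
  have hk' : (0 : ℝ) < k := by exact_mod_cast hk
  have e1 : (k : ℝ) ^ (c - (a + b) / 2 + 3 / 2) =
      (k : ℝ) ^ (1 - a) * (k : ℝ) ^ (1 - b) * (k : ℝ) ^ (1 - c) /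
        ((k : ℝ) ^ (1 - (a + b + 1) / 2) * (k : ℝ) ^ (1 - 2 * c)) := by
    rw [← Real.rpow_add hk', ← Real.rpow_add hk', ← Real.rpow_add hk', ← Real.rpow_sub hk']
    congr 1
    ring
  rw [e1]
  have := Real.rpow_pos_of_pos hk' (1 - (a + b + 1) / 2)
  have := Real.rpow_pos_of_pos hk' (1 - 2 * c)
  have := rf_pos he k
  have := rf_pos h2c k
  simp only [Pi.div_apply, watsonTerm]
  field_simp

lemma summable_watsonTerm {a b c : ℝ} (ha : 0 < a) (hb : 0 < b) (hc : 0 < c)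
    (h : (a + b - 1) / 2 < c) : Summable (watsonTerm a b c) := by
  obtain ⟨L, hL⟩ := tendsto_watsonTerm_mul_rpow ha hb hc
  have hO := hL.isBigO_one ℝ
  have hs : Summable fun k : ℕ => (k : ℝ) ^ (-(c - (a + b) / 2 + 3 / 2)) :=
    Real.summable_nat_rpow.2 (by linarith)
  refine summable_of_isBigO_nat hs ?_
  have h2 := hO.mul (Asymptotics.isBigO_refl
    (fun k : ℕ => (k : ℝ) ^ (-(c - (a + b) / 2 + 3 / 2))) atTop)
  refine h2.congr' ?_ ?_
  · filter_upwards [eventually_gt_atTop 0] with k hk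
    have hk' : (0 : ℝ) < k := by exact_mod_cast hk
    rw [mul_assoc, ← Real.rpow_add hk', add_neg_cancel, Real.rpow_zero, mul_one]
  · simp

lemma tendsto_natCast_mul_watsonTerm {a b c : ℝ} (ha : 0 < a) (hb : 0 < b) (hc : 0 < c)
    (h : (a + b - 1) / 2 < c) :
    Tendsto (fun k : ℕ => (k : ℝ) * watsonTerm a b c k) atTop (𝓝 0) := by
  obtain ⟨L, hL⟩ := tendsto_watsonTerm_mul_rpow ha hb hc
  have h0 : Tendsto (fun k : ℕ => (k : ℝ) ^ (-(c - (a + b - 1) / 2))) atTop (𝓝 0) :=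
    (tendsto_rpow_neg_atTop (by linarith)).comp tendsto_natCast_atTop_atTop
  have h2 := hL.mul h0
  rw [mul_zero] at h2
  refine h2.congr' ?_
  filter_upwards [eventually_gt_atTop 0] with k hk
  have hk' : (0 : ℝ) < k := by exact_mod_cast hk
  rw [mul_assoc, ← Real.rpow_add hk', mul_comm]
  congr 1
  rw [show c - (a + b) / 2 + 3 / 2 + -(c - (a + b - 1) / 2) = 1 by ring, Real.rpow_one]

lemma watsonTerm_succ (a b c : ℝ) (k : ℕ) :
    watsonTerm a b c (k + 1) = watsonTerm a b c k *
      ((a + k) * (b + k) * (c + k) / (((a + b + 1) / 2 + k) * (2 * c + k) * (k + 1))) := by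
  simp only [watsonTerm, rf_succ, Nat.factorial_succ]
  push_cast
  rw [div_mul_div_comm]
  congr 1 <;> ring

lemma gaussTerm_succ (a b : ℝ) (k : ℕ) :
    gaussTerm a b (k + 1) = gaussTerm a b k *
      ((a + k) * (b + k) / ((a + b + 1 + 2 * k) * (k + 1))) := by
  simp only [gaussTerm, rf_succ, Nat.factorial_succ]
  push_cast
  rw [div_mul_div_comm]
  congr 1 <;> ring

lemma watsonTerm_add_one (a b : ℝ) {c : ℝ} (hc : 0 < c) (k : ℕ) :
    watsonTerm a b (c + 1) k = watsonTerm a b c k *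
      (2 * (2 * c + 1) * (c + k) / ((2 * c + k) * (2 * c + k + 1))) := by
  have e : 2 * (c + 1) = 2 * c + 1 + 1 := by ring
  have := rf_pos (show 0 < 2 * c by positivity) k
  simp only [watsonTerm]
  rw [e, rf_add_one (by positivity : 2 * c + 1 ≠ 0), rf_add_one (by positivity : 2 * c ≠ 0),
    rf_add_one hc.ne']
  field_simp
  ring_nf

lemma gaussTerm_add_two {a b : ℝ} (ha : 0 < a) (hb : 0 < b) (k : ℕ) :
    gaussTerm (a + 2) b k = gaussTerm a b k *
      ((a + k) * (a + k + 1) * (a + b + 1) / (a * (a + 1) * (a + b + 1 + 2 * k))) := by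
  have e : (a + 2 + b + 1) / 2 = (a + b + 1) / 2 + 1 := by ring
  have e' : a + 2 = a + 1 + 1 := by ring
  have he : (a + b + 1) / 2 ≠ 0 := by positivity
  have := rf_pos (show 0 < (a + b + 1) / 2 by positivity) k
  simp only [gaussTerm]
  rw [e, e', rf_add_one (by positivity : a + 1 ≠ 0), rf_add_one ha.ne', rf_add_one he]
  field_simp
  ring_nf

lemma hasSum_of_telescope {f G : ℕ → ℝ} (hf : Summable f) (hG : Tendsto G atTop (𝓝 0))
    (h : ∀ k, f k = G (k + 1) - G k) : HasSum f (-G 0) := by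
  have h1 := hf.hasSum.tendsto_sum_nat
  have h2 : Tendsto (fun n => ∑ k ∈ range n, f k) atTop (𝓝 (0 - G 0)) := by
    simp only [h, sum_range_sub]
    exact hG.sub_const _
  rw [zero_sub] at h2
  rw [← tendsto_nhds_unique h1 h2]
  exact hf.hasSum

lemma tsum_watsonTerm_add_one {a b c : ℝ} (ha : 0 < a) (hb : 0 < b) (hc : 0 < c)
    (h : (a + b - 1) / 2 < c) :
    (2 * c + 1 - a) * (2 * c + 1 - b) * ∑' k, watsonTerm a b (c + 1) k =
      (2 * c + 1) * (2 * c + 1 - a - b) * ∑' k, watsonTerm a b c k := by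
  have s1 := summable_watsonTerm ha hb (c := c + 1) (by positivity) (by linarith)
  have s0 := summable_watsonTerm ha hb hc h
  have hs := (s1.hasSum.mul_left ((2 * c + 1 - a) * (2 * c + 1 - b))).sub
    (s0.hasSum.mul_left ((2 * c + 1) * (2 * c + 1 - a - b)))
  have ht := hasSum_of_telescope (G := fun k : ℕ => 2 * (2 * c + 1) *
    ((k : ℝ) * watsonTerm a b c k) * ((a + b - 1 + 2 * k) / (2 * (2 * c + k)))) hs.summable ?_ ?_
  · have := hs.unique ht
    simp only [Nat.cast_zero, zero_mul, mul_zero, neg_zero] at this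
    linarith
  · have h1 : Tendsto (fun k : ℕ => ((a + b - 1 + 2 * k) / (2 * (2 * c + k)) : ℝ)) atTop (𝓝 1) := by
      have h2 : Tendsto (fun k : ℕ => (k : ℝ) + 2 * c) atTop atTop :=
        tendsto_atTop_add_const_right _ _ tendsto_natCast_atTop_atTop
      have h3 := (h2.const_div_atTop ((a + b - 1 - 4 * c) / 2)).const_add 1
      rw [add_zero] at h3
      refine h3.congr fun k => ?_
      have : (0 : ℝ) < k + 2 * c := by positivity
      field_simp
      ring
    have h4 := ((tendsto_natCast_mul_watsonTerm ha hb hc h).const_mul (2 * (2 * c + 1))).mul h1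
    simpa using h4
  · intro k
    simp only [watsonTerm_succ, watsonTerm_add_one a b hc]
    push_cast
    have : (0 : ℝ) < 2 * c + k := by positivity
    have : (0 : ℝ) < a + b + 1 + 2 * k := by positivity
    have : (0 : ℝ) < (a + b + 1) / 2 + k := by positivity
    field_simp
    ring

lemma watsonTerm_eq_prod (a b c : ℝ) (k : ℕ) :
    watsonTerm a b c k = rf a k * rf b k / (rf ((a + b + 1) / 2) k * (k ! : ℝ)) *
      ∏ j ∈ range k, (c + j) / (2 * c + j) := by
  rw [prod_div_distrib]
  change _ = _ * (rf c k / rf (2 * c) k)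
  rw [watsonTerm, div_mul_div_comm]
  congr 1; ring

lemma gaussTerm_eq (a b : ℝ) (k : ℕ) :
    gaussTerm a b k = rf a k * rf b k / (rf ((a + b + 1) / 2) k * (k ! : ℝ)) *
      ∏ _j ∈ range k, (1 / 2 : ℝ) := by
  rw [prod_const, card_range, gaussTerm, one_div, inv_pow, ← div_eq_mul_inv, div_div]

lemma rf_coeff_nonneg {a b : ℝ} (ha : 0 < a) (hb : 0 < b) (k : ℕ) :
    0 ≤ rf a k * rf b k / (rf ((a + b + 1) / 2) k * (k ! : ℝ)) := by
  have := rf_pos ha k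
  have := rf_pos hb k
  have := rf_pos (show 0 < (a + b + 1) / 2 by positivity) k
  positivity

lemma gaussTerm_le_watsonTerm {a b c : ℝ} (ha : 0 < a) (hb : 0 < b) (hc : 0 < c) (k : ℕ) :
    gaussTerm a b k ≤ watsonTerm a b c k := by
  rw [gaussTerm_eq, watsonTerm_eq_prod]
  refine mul_le_mul_of_nonneg_left (prod_le_prod (fun _ _ => by positivity) fun j _ => ?_)
    (rf_coeff_nonneg ha hb k)
  rw [div_le_div_iff₀ (by positivity) (by positivity)]
  have : (0 : ℝ) ≤ j := by positivity
  linarith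

lemma watsonTerm_antitone {a b c c' : ℝ} (ha : 0 < a) (hb : 0 < b) (hc : 0 < c) (h : c ≤ c')
    (k : ℕ) : watsonTerm a b c' k ≤ watsonTerm a b c k := by
  have hc' : 0 < c' := hc.trans_le h
  rw [watsonTerm_eq_prod, watsonTerm_eq_prod]
  refine mul_le_mul_of_nonneg_left (prod_le_prod (fun _ _ => by positivity) fun j _ => ?_)
    (rf_coeff_nonneg ha hb k)
  rw [div_le_div_iff₀ (by positivity) (by positivity)]
  have : (0 : ℝ) ≤ j := by positivity
  nlinarith

lemma summable_gaussTerm {a b : ℝ} (ha : 0 < a) (hb : 0 < b) : Summable (gaussTerm a b) :=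
  (summable_watsonTerm ha hb (c := a + b) (by positivity) (by linarith)).of_nonneg_of_le
    (fun k => (gaussTerm_pos ha hb k).le)
    (gaussTerm_le_watsonTerm ha hb (by positivity))

lemma tendsto_natCast_mul_gaussTerm {a b : ℝ} (ha : 0 < a) (hb : 0 < b) :
    Tendsto (fun k : ℕ => (k : ℝ) * gaussTerm a b k) atTop (𝓝 0) := by
  refine squeeze_zero (fun k => ?_) (fun k => ?_) (tendsto_natCast_mul_watsonTerm ha hb
    (c := a + b) (by positivity) (by linarith))
  · have := gaussTerm_pos ha hb k
    positivity
  · exact mul_le_mul_of_nonneg_left (gaussTerm_le_watsonTerm ha hb (by positivity) k)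
      (by positivity)

lemma tendsto_tsum_watsonTerm {a b c : ℝ} (ha : 0 < a) (hb : 0 < b) (hc : 0 < c)
    (h : (a + b - 1) / 2 < c) :
    Tendsto (fun s : ℕ => ∑' k, watsonTerm a b (c + s) k) atTop (𝓝 (∑' k, gaussTerm a b k)) := by
  refine tendsto_tsum_of_dominated_convergence (summable_watsonTerm ha hb hc h) (fun k => ?_)
    (Eventually.of_forall fun s k => ?_)
  · simp only [watsonTerm_eq_prod, gaussTerm_eq]
    refine (tendsto_finsetProd (range k) fun j _ => ?_).const_mul _
    have h2 : Tendsto (fun s : ℕ => (s : ℝ) + (c + j / 2)) atTop atTop :=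
      tendsto_atTop_add_const_right _ _ tendsto_natCast_atTop_atTop
    have h3 := (h2.const_div_atTop ((j : ℝ) / 4)).const_add (1 / 2)
    rw [add_zero] at h3
    refine h3.congr fun s => ?_
    have : (0 : ℝ) < s + (c + j / 2) := by positivity
    have : (0 : ℝ) < 2 * (c + s) + j := by positivity
    field_simp
    ring
  · rw [Real.norm_of_nonneg (watsonTerm_pos ha hb (by positivity) k).le]
    exact watsonTerm_antitone ha hb hc (by simp) k

lemma tendsto_rf_ratio {x y z w : ℝ} (hx : 0 < x) (hy : 0 < y) (hz : 0 < z) (hw : 0 < w)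
    (h : x + y = z + w) :
    Tendsto (fun s : ℕ => rf x s * rf y s / (rf z s * rf w s)) atTop
      (𝓝 (Real.Gamma z * Real.Gamma w / (Real.Gamma x * Real.Gamma y))) := by
  have gz := Real.Gamma_pos_of_pos hz
  have gw := Real.Gamma_pos_of_pos hw
  have h1 := ((tendsto_rf hx).mul (tendsto_rf hy)).div ((tendsto_rf hz).mul (tendsto_rf hw))
    (by positivity)
  have e : (Real.Gamma x)⁻¹ * (Real.Gamma y)⁻¹ / ((Real.Gamma z)⁻¹ * (Real.Gamma w)⁻¹) =
      Real.Gamma z * Real.Gamma w / (Real.Gamma x * Real.Gamma y) := by field_simp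
  rw [← e]
  refine h1.congr' ?_
  filter_upwards [eventually_gt_atTop 0] with k hk
  have hk' : (0 : ℝ) < k := by exact_mod_cast hk
  have e1 : (k : ℝ) ^ (1 - x) * (k : ℝ) ^ (1 - y) = (k : ℝ) ^ (1 - z) * (k : ℝ) ^ (1 - w) := by
    rw [← Real.rpow_add hk', ← Real.rpow_add hk']
    congr 1
    linarith
  have := Real.rpow_pos_of_pos hk' (1 - z)
  have := Real.rpow_pos_of_pos hk' (1 - w)
  have := rf_pos hz k
  have := rf_pos hw k
  have hf : (0 : ℝ) < (k ! : ℝ) := by positivity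
  simp only [Pi.div_apply]
  rw [div_mul_div_comm, div_mul_div_comm, div_div_div_cancel_right₀ (by positivity),
    mul_mul_mul_comm, e1, mul_mul_mul_comm (rf z k), mul_div_mul_right _ _ (by positivity)]

/-- Watson's theorem, up to the evaluation of Gauss's series. -/
theorem tsum_watsonTerm {a b c : ℝ} (ha : 0 < a) (hb : 0 < b) (hc : 0 < c)
    (h : (a + b - 1) / 2 < c) :
    ∑' k, watsonTerm a b c k = (∑' k, gaussTerm a b k) *
      (Real.Gamma (c + 1 / 2) * Real.Gamma (c + (1 - a - b) / 2) /
        (Real.Gamma (c + (1 - a) / 2) * Real.Gamma (c + (1 - b) / 2))) := by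
  have hx : 0 < c + 1 / 2 := by positivity
  have hy : 0 < c + (1 - a - b) / 2 := by linarith
  have hz : 0 < c + (1 - a) / 2 := by linarith
  have hw : 0 < c + (1 - b) / 2 := by linarith
  have key : ∀ s : ℕ, ∑' k, watsonTerm a b (c + s) k = (∑' k, watsonTerm a b c k) *
      (rf (c + 1 / 2) s * rf (c + (1 - a - b) / 2) s /
        (rf (c + (1 - a) / 2) s * rf (c + (1 - b) / 2) s)) := by
    intro s
    induction s with
    | zero => simp [rf_zero]
    | succ s ih =>
      have hs : (0 : ℝ) ≤ s := by positivity
      have hr := tsum_watsonTerm_add_one ha hb (c := c + s) (by positivity) (by linarith)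
      rw [ih] at hr
      have p1 : 0 < 2 * (c + s) + 1 - a := by linarith
      have p2 : 0 < 2 * (c + s) + 1 - b := by linarith
      have q1 := rf_pos hz s
      have q2 := rf_pos hw s
      rw [Nat.cast_succ, ← add_assoc, eq_div_of_mul_eq (by positivity)
        ((mul_comm _ _).trans hr)]
      simp only [rf_succ]
      have e1 : c + (1 - a) / 2 + s = (2 * (c + s) + 1 - a) / 2 := by ring
      have e2 : c + (1 - b) / 2 + s = (2 * (c + s) + 1 - b) / 2 := by ring
      rw [e1, e2]
      field_simp
      ring
  have h1 := tendsto_tsum_watsonTerm ha hb hc h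
  simp only [key] at h1
  have h2 := (tendsto_rf_ratio hx hy hz hw (by ring)).const_mul (∑' k, watsonTerm a b c k)
  have := Real.Gamma_pos_of_pos hx
  have := Real.Gamma_pos_of_pos hy
  have := Real.Gamma_pos_of_pos hz
  have := Real.Gamma_pos_of_pos hw
  rw [tendsto_nhds_unique h1 h2, mul_assoc, div_mul_div_comm, mul_comm (Real.Gamma (c + 1 / 2) * _),
    div_self (by positivity), mul_one]

lemma tsum_gaussTerm_two_left {b : ℝ} (hb : 0 < b) : ∑' k, gaussTerm 2 b k = b + 1 := by
  have hs := summable_gaussTerm two_pos hb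
  have ht := hasSum_of_telescope
    (G := fun k : ℕ => -(gaussTerm 2 b k * ((b + 1 + 2 * k) / (k + 1)))) hs ?_ ?_
  · rw [ht.tsum_eq]
    simp [gaussTerm, rf_zero]
  · have h1 := (tendsto_one_div_add_atTop_nhds_zero_nat (𝕜 := ℝ)).const_mul (b - 1)
    have h2 := (hs.tendsto_atTop_zero.mul (h1.const_add 2)).neg
    rw [zero_mul, neg_zero] at h2
    refine h2.congr fun k => ?_
    field_simp
    ring
  · intro k
    rw [gaussTerm_succ]
    push_cast
    have : (0 : ℝ) < 2 + b + 1 + 2 * k := by positivity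
    field_simp
    ring

lemma tsum_gaussTerm_add_two {a b : ℝ} (ha : 0 < a) (hb : 0 < b) :
    (a + 1) * ∑' k, gaussTerm (a + 2) b k = (a + b + 1) * ∑' k, gaussTerm a b k := by
  have s1 := summable_gaussTerm (a := a + 2) (by positivity) hb
  have s0 := summable_gaussTerm ha hb
  have hs := (s1.hasSum.mul_left (a + 1)).sub (s0.hasSum.mul_left (a + b + 1))
  have ht := hasSum_of_telescope
    (G := fun k : ℕ => -((a + b + 1) / a) * ((k : ℝ) * gaussTerm a b k)) hs.summable ?_ ?_
  · have := hs.unique ht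
    simp only [Nat.cast_zero, zero_mul, mul_zero, neg_zero] at this
    linarith
  · simpa using (tendsto_natCast_mul_gaussTerm ha hb).const_mul (-((a + b + 1) / a))
  · intro k
    rw [gaussTerm_succ, gaussTerm_add_two ha hb]
    push_cast
    have : (0 : ℝ) < a + b + 1 + 2 * k := by positivity
    field_simp
    ring

lemma gaussTerm_comm (a b : ℝ) : gaussTerm a b = gaussTerm b a := by
  funext k
  rw [gaussTerm, gaussTerm, mul_comm (rf a k), add_comm a b]

lemma gaussTerm_one_one (k : ℕ) :
    gaussTerm 1 1 k = ∫ x in (0 : ℝ)..Real.pi, Real.sin x / 2 * (Real.sin x ^ 2 / 2) ^ k := by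
  have h : ∀ x : ℝ, Real.sin x / 2 * (Real.sin x ^ 2 / 2) ^ k =
      (1 / 2) ^ k / 2 * Real.sin x ^ (2 * k + 1) := fun x => by
    rw [pow_succ (Real.sin x) (2 * k), pow_mul, div_pow, div_pow, one_pow]
    ring
  simp only [h]
  rw [intervalIntegral.integral_const_mul, integral_sin_pow_odd]
  clear h
  induction k with
  | zero => simp [gaussTerm, rf_zero]
  | succ k ih =>
    rw [gaussTerm_succ, ih, prod_range_succ]
    field_simp
    ring

lemma tsum_gaussTerm_one_one : ∑' k, gaussTerm 1 1 k = Real.pi / 2 := by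
  have hbd : ∀ x : ℝ, 0 ≤ Real.sin x ^ 2 / 2 ∧ Real.sin x ^ 2 / 2 ≤ 1 / 2 := fun x =>
    ⟨by positivity, by linarith [Real.sin_sq_le_one x]⟩
  have hsum := intervalIntegral.hasSum_integral_of_dominated_convergence
    (μ := MeasureTheory.volume) (a := 0) (b := Real.pi)
    (F := fun (k : ℕ) x => Real.sin x / 2 * (Real.sin x ^ 2 / 2) ^ k)
    (f := fun x => Real.sin x / (1 + Real.cos x ^ 2)) (fun k _ => (1 / 2 : ℝ) ^ k)
    (fun k => (by fun_prop : Continuous fun x : ℝ =>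
      Real.sin x / 2 * (Real.sin x ^ 2 / 2) ^ k).aestronglyMeasurable)
    (fun k => Eventually.of_forall fun x _ => ?_)
    (Eventually.of_forall fun _ _ => summable_geometric_two)
    intervalIntegrable_const
    (Eventually.of_forall fun x _ => ?_)
  · have hI : ∫ x in (0 : ℝ)..Real.pi, Real.sin x / (1 + Real.cos x ^ 2) = Real.pi / 2 := by
      have hd : ∀ x ∈ Set.uIcc 0 Real.pi, HasDerivAt (fun x => -Real.arctan (Real.cos x))
          (Real.sin x / (1 + Real.cos x ^ 2)) x := fun x _ => by
        refine ((Real.hasDerivAt_cos x).arctan).neg.congr_deriv ?_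
        ring
      have hc : Continuous fun x => Real.sin x / (1 + Real.cos x ^ 2) :=
        Continuous.div (by fun_prop) (by fun_prop) fun x => by positivity
      rw [intervalIntegral.integral_eq_sub_of_hasDerivAt hd (hc.intervalIntegrable _ _)]
      simp only [Real.cos_pi, Real.cos_zero, Real.arctan_neg, Real.arctan_one]
      ring
    rw [hI] at hsum
    simp only [← gaussTerm_one_one] at hsum
    exact hsum.tsum_eq
  · rw [norm_mul, norm_pow, Real.norm_of_nonneg (hbd x).1, Real.norm_eq_abs, abs_div, abs_two]
    have h1 := Real.abs_sin_le_one x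
    have h2 := pow_le_pow_left₀ (hbd x).1 (hbd x).2 k
    have h3 := pow_nonneg (hbd x).1 k
    nlinarith
  · have h := (hasSum_geometric_of_lt_one (hbd x).1 (by linarith [(hbd x).2])).mul_left
      (Real.sin x / 2)
    have e : Real.sin x / 2 * (1 - Real.sin x ^ 2 / 2)⁻¹ =
        Real.sin x / (1 + Real.cos x ^ 2) := by
      have : 0 < 1 + Real.cos x ^ 2 := by positivity
      rw [show 1 - Real.sin x ^ 2 / 2 = (1 + Real.cos x ^ 2) / 2 by rw [Real.sin_sq]; ring]
      field_simp
    rwa [e] at h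

/-- Gauss's second summation theorem propagates along steps of two in the first parameter. -/
lemma tsum_gaussTerm_add_two_mul {a b : ℝ} (ha : 0 < a) (hb : 0 < b)
    (h : ∑' k, gaussTerm a b k = √Real.pi * Real.Gamma ((a + b + 1) / 2) /
      (Real.Gamma ((a + 1) / 2) * Real.Gamma ((b + 1) / 2))) (m : ℕ) :
    ∑' k, gaussTerm (a + 2 * m) b k = √Real.pi * Real.Gamma ((a + 2 * m + b + 1) / 2) /
      (Real.Gamma ((a + 2 * m + 1) / 2) * Real.Gamma ((b + 1) / 2)) := by
  induction m with
  | zero => simpa using h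
  | succ m ih =>
    have hr := tsum_gaussTerm_add_two (a := a + 2 * m) (by positivity) hb
    have e1 : (a + 2 * (m + 1) + b + 1) / 2 = (a + 2 * m + b + 1) / 2 + 1 := by ring
    have e2 : (a + 2 * (m + 1) + 1) / 2 = (a + 2 * m + 1) / 2 + 1 := by ring
    rw [Nat.cast_succ, e1, e2, Real.Gamma_add_one (by positivity),
      Real.Gamma_add_one (by positivity),
      show a + 2 * ((m : ℝ) + 1) = a + 2 * m + 2 by ring,
      eq_div_of_mul_eq (by positivity) ((mul_comm _ _).trans hr), ih]
    have := Real.Gamma_pos_of_pos (show 0 < (a + 2 * m + 1) / 2 by positivity)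
    have := Real.Gamma_pos_of_pos (show 0 < (b + 1) / 2 by positivity)
    generalize Real.Gamma ((a + 2 * m + 1) / 2) = A at *
    generalize Real.Gamma ((b + 1) / 2) = B at *
    generalize Real.Gamma ((a + 2 * m + b + 1) / 2) = C at *
    field_simp

lemma tsum_gaussTerm_odd (m n : ℕ) :
    ∑' k, gaussTerm (1 + 2 * m) (1 + 2 * n) k =
      √Real.pi * Real.Gamma ((1 + 2 * m + (1 + 2 * n) + 1) / 2) /
        (Real.Gamma ((1 + 2 * m + 1) / 2) * Real.Gamma ((1 + 2 * n + 1) / 2)) := by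
  refine tsum_gaussTerm_add_two_mul one_pos (by positivity) ?_ m
  rw [gaussTerm_comm, tsum_gaussTerm_add_two_mul one_pos one_pos ?_ n]
  · rw [mul_comm (Real.Gamma ((1 + 2 * n + 1) / 2)), add_comm (1 + 2 * (n : ℝ)) 1]
  · have h3 : Real.Gamma ((1 + 1 + 1) / 2) = √Real.pi / 2 := by
      rw [show (1 + 1 + 1 : ℝ) / 2 = 1 / 2 + 1 by norm_num, Real.Gamma_add_one (by norm_num),
        Real.Gamma_one_half_eq]
      ring
    have h1 : Real.Gamma ((1 + 1) / 2) = 1 := by norm_num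
    rw [tsum_gaussTerm_one_one, h3, h1, mul_one, div_one, ← mul_div_assoc,
      Real.mul_self_sqrt Real.pi_nonneg]

lemma tsum_gaussTerm_even (m n : ℕ) :
    ∑' k, gaussTerm (2 + 2 * m) (2 + 2 * n) k =
      √Real.pi * Real.Gamma ((2 + 2 * m + (2 + 2 * n) + 1) / 2) /
        (Real.Gamma ((2 + 2 * m + 1) / 2) * Real.Gamma ((2 + 2 * n + 1) / 2)) := by
  refine tsum_gaussTerm_add_two_mul two_pos (by positivity) ?_ m
  have h3 : Real.Gamma ((2 + 1) / 2) = √Real.pi / 2 := by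
    rw [show (2 + 1 : ℝ) / 2 = 1 / 2 + 1 by norm_num, Real.Gamma_add_one (by norm_num),
      Real.Gamma_one_half_eq]
    ring
  have h4 : (2 + (2 + 2 * (n : ℝ)) + 1) / 2 = (2 + 2 * n + 1) / 2 + 1 := by ring
  have := Real.Gamma_pos_of_pos (show (0 : ℝ) < (2 + 2 * n + 1) / 2 by positivity)
  have := Real.sqrt_pos.2 Real.pi_pos
  rw [tsum_gaussTerm_two_left (by positivity), h3, h4, Real.Gamma_add_one (by positivity)]
  field_simp

lemma Gamma_three_halves : Real.Gamma (3 / 2) = √Real.pi / 2 := by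
  rw [show (3 / 2 : ℝ) = 1 / 2 + 1 by norm_num, Real.Gamma_add_one (by norm_num),
    Real.Gamma_one_half_eq]
  ring

lemma tsum_watsonTerm_odd (m n s : ℕ) :
    ∑' k, watsonTerm (1 + 2 * m) (1 + 2 * n) (1 + m + n + s) k =
      Real.pi ^ 2 / 4 * (rf (3 / 2) (m + n + s) * rf (3 / 2) (m + n) * rf (1 / 2) s) /
        ((m ! : ℝ) * (n ! : ℝ) * ((m + s)! : ℝ) * ((n + s)! : ℝ)) := by
  rw [tsum_watsonTerm (by positivity) (by positivity) (by positivity)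
    (by linarith [Nat.cast_nonneg (α := ℝ) s]), tsum_gaussTerm_odd]
  have e1 : (1 + m + n + s : ℝ) + 1 / 2 = 3 / 2 + (m + n + s : ℕ) := by push_cast; ring
  have e2 : (1 + m + n + s : ℝ) + (1 - (1 + 2 * m) - (1 + 2 * n)) / 2 = 1 / 2 + s := by ring
  have e3 : (1 + m + n + s : ℝ) + (1 - (1 + 2 * m)) / 2 = 1 + (n + s : ℕ) := by push_cast; ring
  have e4 : (1 + m + n + s : ℝ) + (1 - (1 + 2 * n)) / 2 = 1 + (m + s : ℕ) := by push_cast; ring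
  have e5 : (1 + 2 * m + (1 + 2 * n) + 1 : ℝ) / 2 = 3 / 2 + (m + n : ℕ) := by push_cast; ring
  have e6 (p : ℕ) : (1 + 2 * p + 1 : ℝ) / 2 = 1 + p := by ring
  rw [e1, e2, e3, e4, e5, e6, e6]
  simp only [Gamma_add_natCast one_pos, Gamma_add_natCast one_half_pos,
    Gamma_add_natCast (show (0 : ℝ) < 3 / 2 by norm_num), Gamma_three_halves,
    Real.Gamma_one_half_eq, Real.Gamma_one, rf_one]
  have h4 : √Real.pi ^ 4 = Real.pi ^ 2 := by
    rw [show 4 = 2 * 2 from rfl, pow_mul, Real.sq_sqrt Real.pi_nonneg]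
  field_simp
  rw [h4]
  ring

lemma tsum_watsonTerm_even (m n s : ℕ) :
    ∑' k, watsonTerm (2 + 2 * m) (2 + 2 * n) (2 + m + n + s) k =
      (rf (3 / 2) (m + n + s + 1) * rf (3 / 2) (m + n + 1) * rf (1 / 2) s) /
        (4 * (rf (1 / 2) (m + 1) * rf (1 / 2) (n + 1) * rf (1 / 2) (m + s + 1) *
          rf (1 / 2) (n + s + 1))) := by
  rw [tsum_watsonTerm (by positivity) (by positivity) (by positivity)
    (by linarith [Nat.cast_nonneg (α := ℝ) s]), tsum_gaussTerm_even]
  have e1 : (2 + m + n + s : ℝ) + 1 / 2 = 3 / 2 + (m + n + s + 1 : ℕ) := by push_cast; ring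
  have e2 : (2 + m + n + s : ℝ) + (1 - (2 + 2 * m) - (2 + 2 * n)) / 2 = 1 / 2 + s := by ring
  have e3 : (2 + m + n + s : ℝ) + (1 - (2 + 2 * m)) / 2 = 1 / 2 + (n + s + 1 : ℕ) := by
    push_cast; ring
  have e4 : (2 + m + n + s : ℝ) + (1 - (2 + 2 * n)) / 2 = 1 / 2 + (m + s + 1 : ℕ) := by
    push_cast; ring
  have e5 : (2 + 2 * m + (2 + 2 * n) + 1 : ℝ) / 2 = 3 / 2 + (m + n + 1 : ℕ) := by
    push_cast; ring
  have e6 (p : ℕ) : (2 + 2 * p + 1 : ℝ) / 2 = 1 / 2 + (p + 1 : ℕ) := by push_cast; ring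
  rw [e1, e2, e3, e4, e5, e6, e6]
  simp only [Gamma_add_natCast one_half_pos,
    Gamma_add_natCast (show (0 : ℝ) < 3 / 2 by norm_num), Gamma_three_halves,
    Real.Gamma_one_half_eq]
  have hr (p : ℕ) := rf_pos (one_half_pos (α := ℝ)) p
  have := hr (m + 1)
  have := hr (n + 1)
  have := hr (m + s + 1)
  have := hr (n + s + 1)
  have := Real.sqrt_pos.2 Real.pi_pos
  field_simp
  ring

/-- The general term of `₃F₂(a, b, c; (a + b + 1) / 2, 2 * c + 1; 1)`. -/
noncomputable def contiguousTerm (a b c : ℝ) (k : ℕ) : ℝ :=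
  rf a k * rf b k * rf c k / (rf ((a + b + 1) / 2) k * rf (2 * c + 1) k * (k ! : ℝ))

lemma watsonTerm_eq_contiguousTerm (a b : ℝ) {c : ℝ} (hc : 0 < c) (k : ℕ) :
    watsonTerm a b c k = contiguousTerm a b c k * (1 + k / (2 * c)) := by
  have := rf_pos (show 0 < 2 * c by positivity) k
  rw [watsonTerm, contiguousTerm, rf_add_one (by positivity : 2 * c ≠ 0)]
  field_simp

lemma add_one_mul_contiguousTerm_succ (a b c : ℝ) (k : ℕ) :
    ((k + 1 : ℕ) : ℝ) * contiguousTerm a b c (k + 1) =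
      a * b * c / ((a + b + 1) / 2 * (2 * c + 1)) *
        watsonTerm (a + 1) (b + 1) (c + 1) k := by
  have e1 : (a + 1 + (b + 1) + 1) / 2 = (a + b + 1) / 2 + 1 := by ring
  have e2 : 2 * (c + 1) = 2 * c + 1 + 1 := by ring
  have hk : ((k + 1 : ℕ) : ℝ) ≠ 0 := by positivity
  rw [watsonTerm, contiguousTerm, e1, e2]
  simp only [rf_succ', Nat.factorial_succ]
  rw [div_mul_div_comm, mul_div_assoc', Nat.cast_mul,
    show (a + b + 1) / 2 * rf ((a + b + 1) / 2 + 1) k * ((2 * c + 1) * rf (2 * c + 1 + 1) k) *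
      (((k + 1 : ℕ) : ℝ) * (k ! : ℝ)) = ((k + 1 : ℕ) : ℝ) * ((a + b + 1) / 2 * (2 * c + 1) *
        (rf ((a + b + 1) / 2 + 1) k * rf (2 * c + 1 + 1) k * (k ! : ℝ))) by ring,
    mul_div_mul_left _ _ hk]
  congr 1
  ring

lemma hasSum_natCast_mul_contiguousTerm {a b c : ℝ} (ha : 0 < a) (hb : 0 < b) (hc : 0 < c)
    (h : (a + b - 1) / 2 < c) :
    HasSum (fun k : ℕ => (k : ℝ) * contiguousTerm a b c k)
      (a * b * c / ((a + b + 1) / 2 * (2 * c + 1)) *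
        ∑' k, watsonTerm (a + 1) (b + 1) (c + 1) k) := by
  have hs := (summable_watsonTerm (a := a + 1) (b := b + 1) (c := c + 1) (by positivity)
    (by positivity) (by positivity) (by linarith)).hasSum.mul_left
      (a * b * c / ((a + b + 1) / 2 * (2 * c + 1)))
  have hs' : HasSum (fun k : ℕ => ((k + 1 : ℕ) : ℝ) * contiguousTerm a b c (k + 1))
      (a * b * c / ((a + b + 1) / 2 * (2 * c + 1)) *
        ∑' k, watsonTerm (a + 1) (b + 1) (c + 1) k) :=
    hs.congr_fun fun k => add_one_mul_contiguousTerm_succ a b c k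
  have h0 := (hasSum_nat_add_iff (f := fun k : ℕ => (k : ℝ) * contiguousTerm a b c k) 1).1 hs'
  rwa [sum_range_one, Nat.cast_zero, zero_mul, add_zero] at h0

lemma poch_add_one_div {d : ℂ} (hd : 0 < d.re) (k : ℕ) :
    poch (d + 1) k / poch d k = 1 + k / d := by
  have hne (j : ℕ) : d + j ≠ 0 := fun h => by
    have := congrArg Complex.re h
    simp only [Complex.add_re, Complex.natCast_re, Complex.zero_re] at this
    linarith [Nat.cast_nonneg (α := ℝ) j]
  have hd0 : d ≠ 0 := by simpa using hne 0
  induction k with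
  | zero => simp [poch]
  | succ k ih =>
    have h1 : d + (k + 1) ≠ 0 := by exact_mod_cast hne (k + 1)
    have h2 := hne k
    simp only [poch, ascPochhammer_succ_eval] at ih ⊢
    rw [← div_mul_div_comm, ih]
    push_cast
    field_simp
    ring

lemma hyp_eq_tsum_watsonTerm {a b c : ℝ} (ha : 0 < a) (hb : 0 < b) (hc : 0 < c)
    (h : (a + b - 1) / 2 < c) {d : ℂ} (hd : 0 < d.re) :
    hyp [(a : ℂ), (b : ℂ), (c : ℂ), d + 1]
        [(((a + b + 1) / 2 : ℝ) : ℂ), ((2 * c + 1 : ℝ) : ℂ), d] 1 =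
      ((∑' k, watsonTerm a b c k : ℝ) : ℂ) + (1 / d - 1 / (2 * c)) *
        ((a * b * c / ((a + b + 1) / 2 * (2 * c + 1)) *
          ∑' k, watsonTerm (a + 1) (b + 1) (c + 1) k : ℝ) : ℂ) := by
  have h1 := Complex.hasSum_ofReal.2 (summable_watsonTerm ha hb hc h).hasSum
  have h2 := (Complex.hasSum_ofReal.2
    (hasSum_natCast_mul_contiguousTerm ha hb hc h)).mul_left (1 / d - 1 / (2 * c))
  rw [← (h1.add h2).tsum_eq, hyp]
  refine tsum_congr fun k => ?_
  have hc' : (c : ℂ) ≠ 0 := by exact_mod_cast hc.ne'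
  have hd0 : d ≠ 0 := fun h => by simp [h] at hd
  simp only [List.map_cons, List.map_nil, List.prod_cons, List.prod_nil, mul_one, one_pow,
    poch_ofReal]
  rw [watsonTerm_eq_contiguousTerm a b hc]
  have e : (rf a k : ℂ) * (rf b k * (rf c k * poch (d + 1) k)) /
      (rf ((a + b + 1) / 2) k * (rf (2 * c + 1) k * poch d k)) / (k ! : ℂ) =
      contiguousTerm a b c k * (poch (d + 1) k / poch d k) := by
    rw [contiguousTerm]
    push_cast
    rw [div_mul_div_comm, div_div]
    congr 1 <;> ring
  rw [e, poch_add_one_div hd]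
  push_cast
  field_simp
  ring

end

theorem extended_watson_formula (m n s : ℕ) (d : ℂ) (hd : 0 < d.re) :
    hyp [1 + 2 * (m : ℂ), 1 + 2 * (n : ℂ), 1 + (m : ℂ) + (n : ℂ) + (s : ℂ), d + 1]
        [(m : ℂ) + (n : ℂ) + 3/2, 3 + 2 * (m : ℂ) + 2 * (n : ℂ) + 2 * (s : ℂ), d] 1 =
      (Real.pi : ℂ) / 4 *
        (poch (3/2) (m + n + s) * poch (3/2) (m + n) * poch (1/2) s /
          (poch (1/2) m * poch (1/2) n * (m ! : ℂ) * (n ! : ℂ))) *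
        ((Real.pi : ℂ) * poch (1/2) m * poch (1/2) n /
            (((m + s)! : ℂ) * ((n + s)! : ℂ)) +
          (1 / (Real.pi : ℂ)) *
            ((2 + 2 * (m : ℂ) + 2 * (n : ℂ) + 2 * (s : ℂ)) / d - 1) *
            ((m ! : ℂ) * (n ! : ℂ)) / (poch (1/2) (m + s + 1) * poch (1/2) (n + s + 1))) := by
  have hs := Nat.cast_nonneg (α := ℝ) s
  have key := hyp_eq_tsum_watsonTerm (a := 1 + 2 * m) (b := 1 + 2 * n) (c := 1 + m + n + s)
    (by positivity) (by positivity) (by positivity) (by linarith) hd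
  have e1 : (1 + 2 * m + 1 : ℝ) = 2 + 2 * m := by ring
  have e2 : (1 + 2 * n + 1 : ℝ) = 2 + 2 * n := by ring
  have e3 : (1 + m + n + s + 1 : ℝ) = 2 + m + n + s := by ring
  have e4 : (1 + 2 * m + (1 + 2 * n) + 1 : ℝ) / 2 = m + n + 3 / 2 := by ring
  have e5 : (2 * (1 + m + n + s) + 1 : ℝ) = 3 + 2 * m + 2 * n + 2 * s := by ring
  rw [e1, e2, e3, e4, e5, tsum_watsonTerm_odd, tsum_watsonTerm_even] at key
  have hB : (1 + 2 * m : ℝ) * (1 + 2 * n) * (1 + m + n + s) /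
      ((m + n + 3 / 2) * (3 + 2 * m + 2 * n + 2 * s)) *
      ((rf (3 / 2) (m + n + s + 1) * rf (3 / 2) (m + n + 1) * rf (1 / 2) s) /
        (4 * (rf (1 / 2) (m + 1) * rf (1 / 2) (n + 1) * rf (1 / 2) (m + s + 1) *
          rf (1 / 2) (n + s + 1)))) =
      (1 + m + n + s) / 2 * (rf (3 / 2) (m + n + s) * rf (3 / 2) (m + n) * rf (1 / 2) s) /
        (rf (1 / 2) m * rf (1 / 2) n * rf (1 / 2) (m + s + 1) * rf (1 / 2) (n + s + 1)) := by
    have hr (p : ℕ) := rf_pos (one_half_pos (α := ℝ)) p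
    have := hr m
    have := hr n
    have := hr (m + s + 1)
    have := hr (n + s + 1)
    rw [rf_succ _ (m + n + s), rf_succ _ (m + n), rf_succ _ m, rf_succ _ n]
    push_cast
    field_simp
    ring
  rw [hB] at key
  have hp (p : ℕ) : (rf (1 / 2) p : ℂ) ≠ 0 := by
    exact_mod_cast (rf_pos (one_half_pos (α := ℝ)) p).ne'
  have hf (p : ℕ) : (p ! : ℂ) ≠ 0 := by exact_mod_cast p.factorial_ne_zero
  have p1 (p : ℕ) : poch (1 / 2) p = (rf (1 / 2) p : ℂ) := by
    rw [← poch_ofReal]; norm_num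
  have p3 (p : ℕ) : poch (3 / 2) p = (rf (3 / 2) p : ℂ) := by
    rw [← poch_ofReal]; norm_num
  have hd0 : d ≠ 0 := fun h => by simp [h] at hd
  have hc : (1 + m + n + s : ℂ) ≠ 0 := by
    exact_mod_cast (show 1 + m + n + s ≠ 0 by omega)
  have hpi : (Real.pi : ℂ) ≠ 0 := by exact_mod_cast Real.pi_ne_zero
  push_cast at key
  rw [key]
  simp only [p1, p3]
  have := hp m
  have := hp n
  have := hp (m + s + 1)
  have := hp (n + s + 1)
  have := hf m
  have := hf n
  have := hf (m + s)
  have := hf (n + s)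
  field_simp
  ring
end

section
/- For every complex number d with Re(d) > 0, there holds ₃F₂(1/2, 1/2, d+1; 5/2, d; 1) = (3π/8)(1 + 1/(2d)). -/
open scoped Nat

lemma poch_succ (x : ℂ) (k : ℕ) : poch x (k + 1) = poch x k * (x + k) :=
  ascPochhammer_succ_eval k x

lemma poch_add_one_mul (x : ℂ) (k : ℕ) : x * poch (x + 1) k = poch x k * (x + k) := by
  rw [← poch_succ]
  simp [poch, ascPochhammer_succ_left]

lemma poch_ne_zero {x : ℂ} (hx : 0 < x.re) (k : ℕ) : poch x k ≠ 0 := by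
  induction k with
  | zero => simp [poch]
  | succ k ih =>
    rw [poch_succ]
    refine mul_ne_zero ih fun h => ?_
    have h_re := congrArg Complex.re h
    simp only [Complex.add_re, Complex.natCast_re, Complex.zero_re] at h_re
    have : (0 : ℝ) ≤ k := k.cast_nonneg
    linarith

lemma hasSum_ascPochhammer_div_factorial_mul_pow (a : ℝ) {x : ℝ} (hx : |x| < 1) :
    HasSum (fun k : ℕ => (ascPochhammer ℝ k).eval a / k ! * x ^ k) (1 / (1 - x) ^ a) := by
  have h := (Real.one_div_one_sub_rpow_hasFPowerSeriesOnBall_zero a).hasSum (y := x)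
    (by simpa [enorm_eq_nnnorm, ← NNReal.coe_lt_coe] using hx)
  rw [zero_add] at h
  convert! h using 2 with k
  rw [FormalMultilinearSeries.ofScalars_apply_eq, smul_eq_mul]
  congr 1
  rw [Ring.choose, div_eq_iff (by positivity), mul_comm, ← nsmul_eq_mul,
    Ring.factorial_nsmul_multichoose_eq_ascPochhammer, Polynomial.ascPochhammer_smeval_eq_eval]
  congr 1
  ring

lemma integral_sin_pow_mul_cos (n : ℕ) :
    ∫ t in (0 : ℝ)..(Real.pi / 2), Real.sin t ^ n * Real.cos t = 1 / (n + 1) := by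
  have h := integral_sin_pow_mul_cos_pow_odd (a := 0) (b := Real.pi / 2) n 0
  simpa using h

/-- Integrate the binomial series of `(1 - sin² t)^(-1/2) = 1 / cos t` against
`sinᵐ t cos t` over `[0, π/2]`. -/
lemma hasSum_ascPochhammer_half_div (m : ℕ) :
    HasSum (fun k : ℕ => (ascPochhammer ℝ k).eval (1 / 2) / k ! * (1 / (2 * k + m + 1)))
      (∫ t in (0 : ℝ)..(Real.pi / 2), Real.sin t ^ m) := by
  set c : ℕ → ℝ := fun k => (ascPochhammer ℝ k).eval (1 / 2) / k ! with hc
  have hc_nonneg (k : ℕ) : 0 ≤ c k :=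
    div_nonneg (ascPochhammer_pos k _ (by norm_num)).le (by positivity)
  have h_pi : (0 : ℝ) ≤ Real.pi / 2 := by positivity
  have h_series : ∀ t ∈ Set.Ioo 0 (Real.pi / 2),
      HasSum (fun k => c k * (Real.sin t ^ (2 * k + m) * Real.cos t)) (Real.sin t ^ m) := by
    intro t ht
    have h_cos : 0 < Real.cos t :=
      Real.cos_pos_of_mem_Ioo ⟨by linarith [ht.1], ht.2⟩
    have h_sq := Real.sin_sq_add_cos_sq t
    have h := (hasSum_ascPochhammer_div_factorial_mul_pow (1 / 2) (x := Real.sin t ^ 2)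
      (by rw [abs_of_nonneg (sq_nonneg _)]; nlinarith)).mul_right (Real.sin t ^ m * Real.cos t)
    convert! h using 1
    · ext k
      rw [hc]
      ring
    · rw [← Real.sqrt_eq_rpow, show 1 - Real.sin t ^ 2 = Real.cos t ^ 2 by linarith,
        Real.sqrt_sq h_cos.le]
      field_simp
  have h_ae : ∀ᵐ t : ℝ, t ∈ Set.uIoc 0 (Real.pi / 2) → t ∈ Set.Ioo 0 (Real.pi / 2) := by
    filter_upwards [MeasureTheory.Measure.ae_ne MeasureTheory.volume (Real.pi / 2)] with t ht hmem
    rw [Set.uIoc_of_le h_pi] at hmem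
    exact ⟨hmem.1, lt_of_le_of_ne hmem.2 ht⟩
  have h_cont : Continuous fun t : ℝ => Real.sin t ^ m := by fun_prop
  have h := intervalIntegral.hasSum_integral_of_dominated_convergence
    (μ := MeasureTheory.volume) (a := 0) (b := Real.pi / 2)
    (F := fun k t => c k * (Real.sin t ^ (2 * k + m) * Real.cos t))
    (f := fun t => Real.sin t ^ m)
    (fun k t => c k * (Real.sin t ^ (2 * k + m) * Real.cos t))
    (fun k => Continuous.aestronglyMeasurable (by fun_prop))
    (fun k => by
      filter_upwards [h_ae] with t ht hmem
      have h_mem := ht hmem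
      have h_sin := Real.sin_nonneg_of_nonneg_of_le_pi h_mem.1.le (by linarith [h_mem.2])
      have h_cos := Real.cos_nonneg_of_mem_Icc
        (⟨by linarith [h_mem.1], h_mem.2.le⟩ : t ∈ Set.Icc (-(Real.pi / 2)) (Real.pi / 2))
      have := hc_nonneg k
      exact (Real.norm_of_nonneg (by positivity)).le)
    (by filter_upwards [h_ae] with t ht hmem using (h_series t (ht hmem)).summable)
    ((h_cont.intervalIntegrable 0 (Real.pi / 2)).congr_ae (by
      rw [Filter.EventuallyEq, MeasureTheory.ae_restrict_iff' measurableSet_uIoc]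
      filter_upwards [h_ae] with t ht hmem using (h_series t (ht hmem)).tsum_eq.symm))
    (by filter_upwards [h_ae] with t ht hmem using h_series t (ht hmem))
  convert! h using 2 with k
  rw [intervalIntegral.integral_const_mul, integral_sin_pow_mul_cos]
  push_cast
  rfl

lemma hyp_term_eq {d : ℂ} (hd : 0 < d.re) (k : ℕ) :
    poch (1 / 2) k * poch (1 / 2) k * poch (d + 1) k / (poch (5 / 2) k * poch d k) / (k ! : ℂ) =
      poch (1 / 2) k / (k ! : ℂ) * (1 / (2 * k + 1)) * (3 / 2 - 3 / (4 * d)) +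
        poch (1 / 2) k / (k ! : ℂ) * (1 / (2 * k + 3)) * (-3 / 2 + 9 / (4 * d)) := by
  have hd0 : d ≠ 0 := fun h => by simp [h] at hd
  have h_d := poch_add_one_mul d k
  have h_half := poch_add_one_mul (1 / 2) k
  have h_three := poch_add_one_mul (3 / 2) k
  rw [show (1 / 2 + 1 : ℂ) = 3 / 2 by norm_num] at h_half
  rw [show (3 / 2 + 1 : ℂ) = 5 / 2 by norm_num] at h_three
  have hpd := poch_ne_zero hd k
  have hph : poch (1 / 2) k ≠ 0 := poch_ne_zero (by norm_num) k
  have h1 : (k * 2 + 1 : ℂ) ≠ 0 := by exact_mod_cast (by omega : k * 2 + 1 ≠ 0)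
  have h3 : (k * 2 + 3 : ℂ) ≠ 0 := by exact_mod_cast (by omega : k * 2 + 3 ≠ 0)
  have hf : (k ! : ℂ) ≠ 0 := by exact_mod_cast k.factorial_ne_zero
  have e_d : poch (d + 1) k = poch d k * (d + k) / d := by
    rw [eq_div_iff hd0, mul_comm, h_d]
  have e_five : poch (5 / 2) k = poch (1 / 2) k * ((2 * k + 1) * (2 * k + 3)) / 3 := by
    linear_combination (2 / 3) * h_three + (4 / 3) * (3 / 2 + k) * h_half
  rw [e_d, e_five]
  generalize poch (1 / 2) k = p at *
  field_simp
  ring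

theorem pi_formula_m0 (d : ℂ) (hd : 0 < d.re) :
    hyp [1/2, 1/2, d + 1] [5/2, d] 1 =
      3 * (Real.pi : ℂ) / 8 * (1 + 1 / (2 * d)) := by
  have hd0 : d ≠ 0 := fun h => by simp [h] at hd
  have h_poch (k : ℕ) : (((ascPochhammer ℝ k).eval (1 / 2) : ℝ) : ℂ) = poch (1 / 2) k := by
    have := ascPochhammer_eval₂ Complex.ofRealHom k (Complex.ofRealHom (1 / 2))
    rw [Polynomial.eval₂_at_apply] at this
    simpa [poch] using this.symm
  have h_zero := Complex.hasSum_ofReal.mpr (hasSum_ascPochhammer_half_div 0)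
  have h_two := Complex.hasSum_ofReal.mpr (hasSum_ascPochhammer_half_div 2)
  have h_sum := (h_zero.mul_right (3 / 2 - 3 / (4 * d))).add
    (h_two.mul_right (-3 / 2 + 9 / (4 * d)))
  rw [integral_sin_sq] at h_sum
  rw [hyp, tsum_congr (fun k => ?_), h_sum.tsum_eq]
  · simp
    field_simp
    ring
  · have := hyp_term_eq hd k
    simp only [List.map_cons, List.map_nil, List.prod_cons, List.prod_nil, mul_one, one_pow]
    rw [← mul_assoc, this]
    push_cast
    rw [h_poch]
    ring
end

section
/- For every complex number d with Re(d) > 0, there holds ₃F₂(3/2, −1/2, d+1; 7/2, d; 1/2) = 15π√2/(32d) + (5√2/8)(1 − 5/(2d)). -/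
open scoped Nat

/-- The binomial coefficients `(-1/2)_k / k!` of `√(1 - y)`. -/
noncomputable def sqrtCoeff (k : ℕ) : ℝ := (ascPochhammer ℝ k).eval (-1 / 2) / (k ! : ℝ)

lemma abs_sqrtCoeff_le_one (k : ℕ) : |sqrtCoeff k| ≤ 1 := by
  induction k with
  | zero => simp [sqrtCoeff]
  | succ k ih =>
    have hrec : sqrtCoeff (k + 1) = sqrtCoeff k * ((k - 1 / 2) / (k + 1)) := by
      have hk : (k ! : ℝ) ≠ 0 := by positivity
      rw [sqrtCoeff, sqrtCoeff, ascPochhammer_succ_eval, Nat.factorial_succ]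
      push_cast
      field_simp
      ring
    have hfac : |((k : ℝ) - 1 / 2) / (k + 1)| ≤ 1 := by
      have hk : (0 : ℝ) ≤ k := k.cast_nonneg
      rw [abs_le, le_div_iff₀ (by positivity), div_le_iff₀ (by positivity)]
      constructor <;> linarith
    rw [hrec, abs_mul]
    exact mul_le_one₀ ih (abs_nonneg _) hfac

lemma hasSum_sqrtCoeff {y : ℝ} (hy : |y| < 1) :
    HasSum (fun k ↦ sqrtCoeff k * y ^ k) (√(1 - y)) := by
  have h := (Real.one_div_one_sub_rpow_hasFPowerSeriesOnBall_zero (-1 / 2)).hasSum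
    (y := y) (by simpa [Metric.mem_eball, edist_zero_right, ← ofReal_norm] using hy)
  have hy' : 0 ≤ 1 - y := by linarith [(abs_lt.mp hy).2]
  convert! h using 1
  · ext k
    have hc : sqrtCoeff k = Ring.choose (-1 / 2 + (k : ℝ) - 1) k := by
      rw [← Ring.multichoose_eq, sqrtCoeff, ← Polynomial.ascPochhammer_smeval_eq_eval,
        ← Ring.factorial_nsmul_multichoose_eq_ascPochhammer, nsmul_eq_mul]
      field_simp
    simp [hc, mul_comm]
  · rw [zero_add, Real.sqrt_eq_rpow, neg_div, Real.rpow_neg hy']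
    simp

lemma hasSum_integral_sin_pow_mul_cos_sq (n : ℕ) :
    HasSum (fun k ↦ sqrtCoeff k * ((√2 / 2) ^ (2 * k + n + 1) / (2 * k + n + 1)))
      (∫ θ in (0 : ℝ)..(Real.pi / 4), Real.sin θ ^ n * Real.cos θ ^ 2) := by
  have hint (k : ℕ) : ∫ θ in (0 : ℝ)..(Real.pi / 4),
      sqrtCoeff k * (Real.sin θ ^ (2 * k + n) * Real.cos θ) =
        sqrtCoeff k * ((√2 / 2) ^ (2 * k + n + 1) / (2 * k + n + 1)) := by
    have hk : (2 * k + n + 1 : ℝ) ≠ 0 := by positivity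
    rw [intervalIntegral.integral_const_mul,
      intervalIntegral.integral_eq_sub_of_hasDerivAt
        (f := fun θ ↦ Real.sin θ ^ (2 * k + n + 1) / (2 * k + n + 1))]
    · simp
    · intro θ _
      convert! ((Real.hasDerivAt_sin θ).pow (2 * k + n + 1)).div_const (2 * k + n + 1 : ℝ) using 1
      rw [add_tsub_cancel_right]
      push_cast
      field_simp
    · exact Continuous.intervalIntegrable (by fun_prop) _ _
  simp_rw [← hint]
  have hmem {θ : ℝ} (hθ : θ ∈ Set.uIoc 0 (Real.pi / 4)) :
      0 ≤ Real.cos θ ∧ Real.sin θ ^ 2 ≤ 1 / 2 := by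
    rw [Set.uIoc_of_le (by positivity)] at hθ
    have hpi := Real.pi_pos
    refine ⟨Real.cos_nonneg_of_mem_Icc ⟨by linarith [hθ.1], by linarith [hθ.2]⟩, ?_⟩
    have h2 : 0 ≤ Real.cos (2 * θ) :=
      Real.cos_nonneg_of_mem_Icc ⟨by linarith [hθ.1], by linarith [hθ.2]⟩
    rw [Real.cos_two_mul, Real.cos_sq'] at h2
    linarith
  refine intervalIntegral.hasSum_integral_of_dominated_convergence
    (fun k _ ↦ (1 / 2 : ℝ) ^ k) (fun k ↦ Continuous.aestronglyMeasurable (by fun_prop))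
    (fun k ↦ .of_forall fun θ hθ ↦ ?_) (.of_forall fun _ _ ↦ summable_geometric_two)
    intervalIntegrable_const (.of_forall fun θ hθ ↦ ?_)
  · have hs := pow_le_pow_left₀ (sq_nonneg _) (hmem hθ).2 k
    have h1 : |Real.sin θ ^ n * Real.cos θ| ≤ 1 := by
      rw [abs_mul, abs_pow]
      exact mul_le_one₀ (pow_le_one₀ (abs_nonneg _) (Real.abs_sin_le_one θ)) (abs_nonneg _)
        (Real.abs_cos_le_one θ)
    rw [pow_add, pow_mul, mul_assoc, norm_mul, norm_mul, Real.norm_eq_abs, Real.norm_eq_abs,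
      Real.norm_eq_abs, abs_of_nonneg (by positivity : 0 ≤ (Real.sin θ ^ 2) ^ k)]
    calc _ ≤ 1 * ((1 / 2 : ℝ) ^ k * 1) := by
          gcongr
          exact abs_sqrtCoeff_le_one k
      _ = _ := by ring
  · obtain ⟨hc, hs⟩ := hmem hθ
    have h := (hasSum_sqrtCoeff (y := Real.sin θ ^ 2)
      (by rw [abs_of_nonneg (sq_nonneg _)]; linarith)).mul_right (Real.sin θ ^ n * Real.cos θ)
    rw [← Real.cos_sq', Real.sqrt_sq hc] at h
    convert! h using 1
    · ext k
      ring
    · ring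

lemma integral_sin_pow_four_mul_cos_sq :
    ∫ θ in (0 : ℝ)..(Real.pi / 4), Real.sin θ ^ 4 * Real.cos θ ^ 2 = Real.pi / 64 - 1 / 48 := by
  rw [intervalIntegral.integral_eq_sub_of_hasDerivAt
    (f := fun θ ↦ θ / 16 - Real.sin (4 * θ) / 64 - Real.sin (2 * θ) ^ 3 / 48)]
  · rw [show 4 * (Real.pi / 4) = Real.pi by ring, show 2 * (Real.pi / 4) = Real.pi / 2 by ring]
    simp
    ring
  · intro θ _
    have h4 : HasDerivAt (fun θ : ℝ ↦ Real.sin (4 * θ)) (Real.cos (4 * θ) * 4) θ := by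
      simpa using ((hasDerivAt_id θ).const_mul 4).sin
    have h2 : HasDerivAt (fun θ : ℝ ↦ Real.sin (2 * θ)) (Real.cos (2 * θ) * 2) θ := by
      simpa using ((hasDerivAt_id θ).const_mul 2).sin
    convert! (((hasDerivAt_id θ).div_const 16).sub (h4.div_const 64)).sub
      ((h2.pow 3).div_const 48) using 1
    rw [show 4 * θ = 2 * (2 * θ) by ring, Real.cos_two_mul (2 * θ), Real.sin_two_mul,
      Real.cos_two_mul]
    rw [show Real.sin θ ^ 4 = (Real.sin θ ^ 2) ^ 2 by ring]
    ring_nf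
    rw [show Real.sin θ ^ 4 = (Real.sin θ ^ 2) ^ 2 by ring, Real.sin_sq]
    ring
  · exact Continuous.intervalIntegrable (by fun_prop) _ _

lemma hasSum_sqrtCoeff_div_two_mul_add_three :
    HasSum (fun k : ℕ ↦ sqrtCoeff k * (1 / 2) ^ k / (2 * k + 3)) (√2 * Real.pi / 16) := by
  have h := (hasSum_integral_sin_pow_mul_cos_sq 2).mul_left (2 * √2)
  have hs : √2 ^ 2 = 2 := Real.sq_sqrt (by norm_num)
  convert! h using 1
  · ext k
    rw [show 2 * k + 2 + 1 = 2 * k + 3 by ring, pow_add, pow_mul,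
      show (√2 / 2) ^ 2 = 1 / 2 by rw [div_pow, hs]; norm_num,
      show (√2 / 2) ^ 3 = √2 / 4 by rw [div_pow, pow_succ, hs]; ring]
    push_cast
    field_simp
    rw [hs]
    ring
  · rw [integral_sin_sq_mul_cos_sq, show 4 * (Real.pi / 4) = Real.pi by ring]
    simp
    ring

lemma hasSum_sqrtCoeff_div_two_mul_add_five :
    HasSum (fun k : ℕ ↦ sqrtCoeff k * (1 / 2) ^ k / (2 * k + 5))
      (4 * √2 * (Real.pi / 64 - 1 / 48)) := by
  have h := (hasSum_integral_sin_pow_mul_cos_sq 4).mul_left (4 * √2)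
  have hs : √2 ^ 2 = 2 := Real.sq_sqrt (by norm_num)
  rw [integral_sin_pow_four_mul_cos_sq] at h
  convert! h using 1
  ext k
  rw [show 2 * k + 4 + 1 = 2 * k + 5 by ring, pow_add, pow_mul,
    show (√2 / 2) ^ 2 = 1 / 2 by rw [div_pow, hs]; norm_num,
    show (√2 / 2) ^ 5 = √2 / 8 by
      rw [div_pow, show √2 ^ 5 = (√2 ^ 2) ^ 2 * √2 by ring, hs]; ring]
  push_cast
  field_simp
  rw [hs]
  ring

lemma mul_poch_add_one (x : ℂ) (k : ℕ) : x * poch (x + 1) k = (x + k) * poch x k := by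
  induction k with
  | zero => simp [poch]
  | succ k ih =>
    rw [poch_succ, poch_succ, ← mul_assoc, ih]
    push_cast
    ring

lemma poch_add_one_div_s17 {x : ℂ} (hx : 0 < x.re) (k : ℕ) :
    poch (x + 1) k / poch x k = (x + k) / x := by
  have hx0 : x ≠ 0 := fun h ↦ by simp [h] at hx
  rw [div_eq_div_iff (poch_ne_zero hx k) hx0, ← mul_poch_add_one, mul_comm]

lemma ofReal_sqrtCoeff (k : ℕ) : (sqrtCoeff k : ℂ) = poch (-1 / 2) k / (k ! : ℂ) := by
  have h := Polynomial.eval_map_apply (Complex.ofRealHom) (p := ascPochhammer ℝ k) (-1 / 2 : ℝ)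
  rw [ascPochhammer_map] at h
  simp only [Complex.ofRealHom_eq_coe] at h
  rw [sqrtCoeff, poch, Complex.ofReal_div, ← h]
  push_cast
  rfl

lemma poch_three_halves_div_poch_seven_halves (k : ℕ) :
    poch (3 / 2) k / poch (7 / 2) k = 15 / ((2 * k + 3) * (2 * k + 5)) := by
  have h3 := poch_add_one_div_s17 (x := 3 / 2) (by norm_num) k
  have h5 := poch_add_one_div_s17 (x := 5 / 2) (by norm_num) k
  have hp3 := poch_ne_zero (x := 3 / 2) (by norm_num) k
  have hp5 := poch_ne_zero (x := 5 / 2) (by norm_num) k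
  have hk3 : (2 * k + 3 : ℂ) ≠ 0 := by exact_mod_cast (by positivity : 2 * k + 3 ≠ 0)
  have hk5 : (2 * k + 5 : ℂ) ≠ 0 := by exact_mod_cast (by positivity : 2 * k + 5 ≠ 0)
  rw [show (3 / 2 + 1 : ℂ) = 5 / 2 by norm_num, div_eq_iff hp3] at h3
  rw [show (5 / 2 + 1 : ℂ) = 7 / 2 by norm_num, div_eq_iff hp5] at h5
  rw [h5, h3, show (3 / 2 + k : ℂ) = (2 * k + 3) / 2 by ring,
    show (5 / 2 + k : ℂ) = (2 * k + 5) / 2 by ring]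
  field_simp
  norm_num

theorem bailey_m1_n0 (d : ℂ) (hd : 0 < d.re) :
    hyp [3/2, -1/2, d + 1] [7/2, d] (1/2) =
      15 * (Real.pi : ℂ) * (Real.sqrt 2 : ℂ) / (32 * d) +
        5 * (Real.sqrt 2 : ℂ) / 8 * (1 - 5 / (2 * d)) := by
  have hd0 : d ≠ 0 := fun h ↦ by simp [h] at hd
  have h3 := Complex.hasSum_ofReal.2 hasSum_sqrtCoeff_div_two_mul_add_three
  have h5 := Complex.hasSum_ofReal.2 hasSum_sqrtCoeff_div_two_mul_add_five
  have h := (h3.mul_left (15 / 2 * (1 - 3 / (2 * d)))).sub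
    (h5.mul_left (15 / 2 * (1 - 5 / (2 * d))))
  have hterm (k : ℕ) :
      (([3 / 2, -1 / 2, d + 1].map (poch · k)).prod / ([7 / 2, d].map (poch · k)).prod) *
          (1 / 2) ^ k / (k ! : ℂ) =
        15 / 2 * (1 - 3 / (2 * d)) * ((sqrtCoeff k * (1 / 2) ^ k / (2 * k + 3) : ℝ) : ℂ) -
          15 / 2 * (1 - 5 / (2 * d)) * ((sqrtCoeff k * (1 / 2) ^ k / (2 * k + 5) : ℝ) : ℂ) := by
    have hk3 : (2 * k + 3 : ℂ) ≠ 0 := by exact_mod_cast (by positivity : 2 * k + 3 ≠ 0)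
    have hk5 : (2 * k + 5 : ℂ) ≠ 0 := by exact_mod_cast (by positivity : 2 * k + 5 ≠ 0)
    calc _ = (poch (3 / 2) k / poch (7 / 2) k) * (poch (d + 1) k / poch d k) *
          (poch (-1 / 2) k / (k ! : ℂ)) * (1 / 2) ^ k := by
          simp only [List.map_cons, List.map_nil, List.prod_cons, List.prod_nil, mul_one]
          ring
      _ = _ := by
          rw [poch_three_halves_div_poch_seven_halves, poch_add_one_div_s17 hd, ← ofReal_sqrtCoeff]
          push_cast
          field_simp
          ring
  rw [hyp, tsum_congr hterm, h.tsum_eq]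
  push_cast
  field_simp
  ring
end
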